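/- arXiv:1909.01366 — 4 statements merged into one kernel-verified Lean document; each statement's English description precedes it below -/
import Mathlib

section
/- Let d ≥ 1, let U be any d×d complex matrix, let ψ ∈ ℂ^d, and let i, j ∈ ℤ/d. Let χ := (I ⊗ U)·φ⁺ (a vector indexed by Fin d × Fin d) and let β_{ij} := ((X^i·Z^j)† ⊗ I)·φ⁺. Then the vector w ∈ ℂ^d defined by w(c) = ∑_{a,b} conj(β_{ij}(a,b)) · ψ(a) · χ(b,c) satisfies w = (1/d)·(U·X^i·Z^j)·ψ. (Correctness of gate teleportation: after obtaining Bell outcome (i,j), Bob holds U X^i Z^j ψ, up to the normalization 1/d whose square is the outcome probability 1/d².) -/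
open Matrix
open Kronecker

/-- The maximally entangled vector `φ⁺ = (1/√d) ∑ i, e_i ⊗ e_i` on `ℂ^d ⊗ ℂ^d`. -/
noncomputable def phiPlus (d : ℕ) : Fin d × Fin d → ℂ :=
  fun p => if p.1 = p.2 then ((1 / Real.sqrt d : ℝ) : ℂ) else 0

/-- The shift operator `X^i`: `(X^i)(a,b) = 1` iff `a = b + i (mod d)`. -/
def shiftOp (d : ℕ) (i : ZMod d) : Matrix (Fin d) (Fin d) ℂ :=
  fun a b => if ((a : ℕ) : ZMod d) = ((b : ℕ) : ZMod d) + i then 1 else 0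

/-- The clock operator `Z^j`: diagonal with entries `ω^{j·l}`, `ω = exp(2πi/d)`. -/
noncomputable def clockOp (d : ℕ) (j : ZMod d) : Matrix (Fin d) (Fin d) ℂ :=
  fun a b => if a = b then Complex.exp (2 * Real.pi * Complex.I / d) ^ (j.val * (a : ℕ)) else 0

/-- The generalized Bell vector `β_{ij} = ((X^i Z^j)† ⊗ I) φ⁺`. -/
noncomputable def bellVec (d : ℕ) (i j : ZMod d) : Fin d × Fin d → ℂ :=
  (((shiftOp d i * clockOp d j)ᴴ) ⊗ₖ (1 : Matrix (Fin d) (Fin d) ℂ)).mulVec (phiPlus d)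

/-- The action of `A ⊗ B` on `φ⁺` has the entries of `A Bᵀ`, up to the factor `1/√d`. -/
lemma kronecker_mulVec_phiPlus (d : ℕ) (A B : Matrix (Fin d) (Fin d) ℂ) (a b : Fin d) :
    (A ⊗ₖ B).mulVec (phiPlus d) (a, b) = (A * Bᵀ) a b * ((1 / Real.sqrt d : ℝ) : ℂ) := by
  simp only [Matrix.mulVec, dotProduct, Fintype.sum_prod_type, phiPlus, kroneckerMap_apply,
    mul_ite, mul_zero, Finset.sum_ite_eq, Finset.mem_univ, if_true, Matrix.mul_apply,
    Matrix.transpose_apply, Finset.sum_mul]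

/-- **Correctness of gate teleportation:** with `χ = (I ⊗ U) φ⁺`, projecting the input `ψ`
and Alice's half onto the Bell vector `β_{ij}` leaves Bob with `(1/d)·(U X^i Z^j) ψ`. -/
theorem gate_teleportation (d : ℕ) (hd : 1 ≤ d) (U : Matrix (Fin d) (Fin d) ℂ)
    (ψ : Fin d → ℂ) (i j : ZMod d)
    (χ : Fin d × Fin d → ℂ)
    (hχ : χ = (((1 : Matrix (Fin d) (Fin d) ℂ)) ⊗ₖ U).mulVec (phiPlus d))
    (w : Fin d → ℂ)
    (hw : ∀ c : Fin d, w c = ∑ a : Fin d, ∑ b : Fin d,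
      star (bellVec d i j (a, b)) * ψ a * χ (b, c)) :
    w = (1 / (d : ℂ)) • (U * shiftOp d i * clockOp d j).mulVec ψ := by
  have hsq : ((1 / Real.sqrt d : ℝ) : ℂ) * ((1 / Real.sqrt d : ℝ) : ℂ) = 1 / (d : ℂ) := by
    rw [← Complex.ofReal_mul, div_mul_div_comm, Real.mul_self_sqrt d.cast_nonneg]
    simp
  ext c
  rw [hw, Matrix.mul_assoc, ← Matrix.mulVec_mulVec, Pi.smul_apply, smul_eq_mul, ← hsq]
  simp only [hχ, bellVec, kronecker_mulVec_phiPlus, Matrix.transpose_one, Matrix.mul_one,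
    Matrix.one_mul, star_mul', Matrix.conjTranspose_apply, Matrix.transpose_apply,
    Complex.star_def, Complex.conj_ofReal]
  rw [Finset.sum_comm]
  simp only [Matrix.mulVec, dotProduct, Finset.mul_sum]
  refine Finset.sum_congr rfl fun b _ => Finset.sum_congr rfl fun a _ => ?_
  simp only [Complex.conj_conj]
  ring
end

section
/- Let d ≥ 1, let U be any d×d complex matrix, let ψ ∈ ℂ^d, and let i, j ∈ ℤ/d. Let χ := (U ⊗ I)·φ⁺ (a vector indexed by Fin d × Fin d) and let β_{ij} := ((X^i·Z^j)† ⊗ I)·φ⁺. Then the vector w ∈ ℂ^d defined by w(c) = ∑_{a,b} conj(β_{ij}(a,b)) · ψ(a) · χ(b,c) satisfies w = (1/d)·(Uᵀ·X^i·Z^j)·ψ. (Correctness of the single-use unitary transposition protocol: applying U on Alice's half of the entangled state and performing the generalized Bell measurement implements Uᵀ X^i Z^j, so the transpose Uᵀ is obtained exactly when i = j = 0, which occurs with probability 1/d².) -/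
open Matrix
open Kronecker

/-- A matrix acting on the first factor of `φ⁺` gives its own entries, scaled by `1/√d`. -/
theorem kronecker_one_mulVec_phiPlus (d : ℕ) (A : Matrix (Fin d) (Fin d) ℂ) (a b : Fin d) :
    (A ⊗ₖ (1 : Matrix (Fin d) (Fin d) ℂ)).mulVec (phiPlus d) (a, b) =
      A a b * ((1 / Real.sqrt d : ℝ) : ℂ) := by
  simp [Matrix.mulVec, dotProduct, phiPlus, Fintype.sum_prod_type, Matrix.one_apply]

/-- **Correctness of the single-use unitary transposition protocol:** with `χ = (U ⊗ I) φ⁺`, projecting the input `ψ`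
and Alice's half onto the Bell vector `β_{ij}` leaves Bob with `(1/d)·(Uᵀ X^i Z^j) ψ`. -/
theorem unitary_transposition_single_use (d : ℕ) (hd : 1 ≤ d) (U : Matrix (Fin d) (Fin d) ℂ)
    (ψ : Fin d → ℂ) (i j : ZMod d)
    (χ : Fin d × Fin d → ℂ)
    (hχ : χ = (U ⊗ₖ (1 : Matrix (Fin d) (Fin d) ℂ)).mulVec (phiPlus d))
    (w : Fin d → ℂ)
    (hw : ∀ c : Fin d, w c = ∑ a : Fin d, ∑ b : Fin d,
      star (bellVec d i j (a, b)) * ψ a * χ (b, c)) :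
    w = (1 / (d : ℂ)) • (Uᵀ * shiftOp d i * clockOp d j).mulVec ψ := by
  have hsq : ((1 / Real.sqrt d : ℝ) : ℂ) * ((1 / Real.sqrt d : ℝ) : ℂ) = 1 / (d : ℂ) := by
    rw [← Complex.ofReal_mul, div_mul_div_comm, Real.mul_self_sqrt (Nat.cast_nonneg d)]
    simp
  funext c
  rw [hw, hχ, Matrix.mul_assoc]
  simp only [bellVec, kronecker_one_mulVec_phiPlus, Pi.smul_apply, smul_eq_mul, ← hsq,
    Matrix.conjTranspose_apply, star_mul', star_star]
  rw [Matrix.mulVec, dotProduct, Finset.mul_sum]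
  refine Finset.sum_congr rfl fun a _ => ?_
  rw [Matrix.mul_apply (M := Uᵀ), Finset.sum_mul, Finset.mul_sum]
  refine Finset.sum_congr rfl fun b _ => ?_
  rw [Matrix.transpose_apply, Complex.star_def, Complex.conj_ofReal]
  ring
end

section
/- Let I₀, I, O, O₀ be nonempty finite types with cardinalities d_{I₀}, d_I, d_O, d_{O₀}, and set N := d_{I₀}·d_I·d_O·d_{O₀}. Let S be a positive semidefinite complex matrix indexed by I₀ × I × O × O₀ with trace Tr(S) ≤ d_{I₀}·d_O. Define S_P := (1/N)·S and F_P := (1/(d_I·d_{O₀}))·𝟙 − S_P, where 𝟙 is the identity matrix on I₀ × I × O × O₀. Then: (a) S_P and F_P are both positive semidefinite; (b) their sum C := S_P + F_P = (1/(d_I·d_{O₀}))·𝟙 satisfies the parallel delayed-input-state superchannel conditions: the partial trace of C over O₀ equals (I_{I₀}/d_{I₀}) ⊗ (partial trace of C over I₀, O and O₀) ⊗ (I_O/d_O), and Tr(C) = d_{I₀}·d_O. (This is the Choi-operator content of the lemma that every probabilistic supermap, including ones with indefinite causal order, can be implemented by a parallel delayed input-state protocol with success probability reduced by the factor 1/N.)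 -/
open ComplexOrder

open Matrix in
/-- A positive semidefinite matrix is bounded above by its trace times the identity. -/
theorem Matrix.PosSemidef.trace_smul_one_sub {n : Type*} [Fintype n] [DecidableEq n]
    {A : Matrix n n ℂ} (hA : A.PosSemidef) : (A.trace • (1 : Matrix n n ℂ) - A).PosSemidef := by
  let U : Matrix n n ℂ := (hA.1.eigenvectorUnitary : Matrix n n ℂ)
  have hU : U * Uᴴ = 1 := Unitary.coe_mul_star_self hA.1.eigenvectorUnitary
  have hD : (diagonal fun i => A.trace - (hA.1.eigenvalues i : ℂ)).PosSemidef := by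
    refine PosSemidef.diagonal fun i => sub_nonneg.2 ?_
    rw [hA.1.trace_eq_sum_eigenvalues]
    exact Finset.single_le_sum (f := fun j => (hA.1.eigenvalues j : ℂ))
      (fun j _ => by exact_mod_cast hA.eigenvalues_nonneg j) (Finset.mem_univ i)
  have hA' : A = U * diagonal (fun i => (hA.1.eigenvalues i : ℂ)) * Uᴴ := by
    exact hA.1.spectral_theorem.trans (Unitary.conjStarAlgAut_apply ..)
  convert hD.mul_mul_conjTranspose_same U using 1
  rw [← diagonal_sub, mul_sub, sub_mul, ← hA', ← smul_one_eq_diagonal, Matrix.mul_smul, mul_one,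
    Matrix.smul_mul, hU]

/-- A positive semidefinite matrix is bounded above by any scalar dominating its trace. -/
theorem Matrix.PosSemidef.smul_one_sub_of_trace_le {n : Type*} [Fintype n] [DecidableEq n]
    {A : Matrix n n ℂ} (hA : A.PosSemidef) {c : ℂ} (hc : A.trace ≤ c) :
    (c • (1 : Matrix n n ℂ) - A).PosSemidef := by
  have h := (Matrix.PosSemidef.one.smul (sub_nonneg.2 hc)).add hA.trace_smul_one_sub
  rwa [sub_smul, sub_add_sub_cancel] at h

/-- **Choi-operator content of the "parallelisation" lemma:** any positive semidefinite
superinstrument element `S` with `Tr S ≤ d_{I₀}·d_O` can be rescaled by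
`1/N` (`N = d_{I₀}·d_I·d_O·d_{O₀}`) to a pair `S_P, F_P` of positive semidefinite operators
whose sum `C = (1/(d_I·d_{O₀}))·𝟙` is a valid parallel delayed-input-state superchannel:
`Tr_{O₀} C = (I_{I₀}/d_{I₀}) ⊗ Tr_{I₀ O O₀} C ⊗ (I_O/d_O)` and `Tr C = d_{I₀}·d_O`. -/
theorem parallel_delayed_input_state_implementation
    (I₀ I O O₀ : Type*)
    [Fintype I₀] [Fintype I] [Fintype O] [Fintype O₀]
    [DecidableEq I₀] [DecidableEq I] [DecidableEq O] [DecidableEq O₀]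
    [Nonempty I₀] [Nonempty I] [Nonempty O] [Nonempty O₀]
    (S : Matrix (I₀ × I × O × O₀) (I₀ × I × O × O₀) ℂ)
    (hS : S.PosSemidef)
    (htr : S.trace ≤ ((Fintype.card I₀ * Fintype.card O : ℕ) : ℂ))
    (S_P F_P : Matrix (I₀ × I × O × O₀) (I₀ × I × O × O₀) ℂ)
    (hSP : S_P = (((Fintype.card I₀ * Fintype.card I * Fintype.card O *
        Fintype.card O₀ : ℕ) : ℂ))⁻¹ • S)
    (hFP : F_P = (((Fintype.card I * Fintype.card O₀ : ℕ) : ℂ))⁻¹ •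
        (1 : Matrix (I₀ × I × O × O₀) (I₀ × I × O × O₀) ℂ) - S_P) :
    S_P.PosSemidef ∧ F_P.PosSemidef ∧
    (∀ (x x' : I₀) (i i' : I) (o o' : O),
      (∑ y : O₀, (S_P + F_P) (x, i, o, y) (x', i', o', y)) =
        (if x = x' then ((Fintype.card I₀ : ℕ) : ℂ)⁻¹ else 0) *
        (∑ z : I₀, ∑ o₂ : O, ∑ y : O₀, (S_P + F_P) (z, i, o₂, y) (z, i', o₂, y)) *
        (if o = o' then ((Fintype.card O : ℕ) : ℂ)⁻¹ else 0)) ∧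
    (S_P + F_P).trace = ((Fintype.card I₀ * Fintype.card O : ℕ) : ℂ) := by
  have h₀ : (Fintype.card I₀ : ℂ) ≠ 0 := Nat.cast_ne_zero.2 Fintype.card_ne_zero
  have h₁ : (Fintype.card I : ℂ) ≠ 0 := Nat.cast_ne_zero.2 Fintype.card_ne_zero
  have h₂ : (Fintype.card O : ℂ) ≠ 0 := Nat.cast_ne_zero.2 Fintype.card_ne_zero
  have h₃ : (Fintype.card O₀ : ℂ) ≠ 0 := Nat.cast_ne_zero.2 Fintype.card_ne_zero
  have hN : (0 : ℂ) ≤ ((Fintype.card I₀ * Fintype.card I * Fintype.card O *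
      Fintype.card O₀ : ℕ) : ℂ)⁻¹ := inv_nonneg.2 (Nat.cast_nonneg _)
  have hsum : S_P + F_P = ((Fintype.card I * Fintype.card O₀ : ℕ) : ℂ)⁻¹ •
      (1 : Matrix (I₀ × I × O × O₀) (I₀ × I × O × O₀) ℂ) := by
    rw [hFP, add_sub_cancel]
  refine ⟨hSP ▸ hS.smul hN, ?_, fun x x' i i' o o' => ?_, ?_⟩
  · convert (hS.smul_one_sub_of_trace_le htr).smul hN using 1
    rw [hFP, hSP, smul_sub, smul_smul]
    congr 2
    push_cast
    field_simp
  · simp only [hsum, Matrix.smul_apply, Matrix.one_apply, Prod.mk.injEq, smul_eq_mul]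
    by_cases hx : x = x' <;> by_cases hi : i = i' <;> by_cases ho : o = o' <;>
      simp [hx, hi, ho]
    field_simp
  · rw [hsum, Matrix.trace_smul, Matrix.trace_one]
    simp only [Fintype.card_prod, smul_eq_mul]
    push_cast
    field_simp
end

section
/- Let d, k ≥ 1 and let S be a complex matrix indexed by Fin d × (Fin k → Fin d) × (Fin k → Fin d) × Fin d (the factors corresponding to spaces I₀, I, O, O₀). For a unitary U ∈ U(d), define the operator Ω(U) on the middle factors I × O by Ω(U)[((i,o)),((i',o'))] = conj(U^{⊗k}(o,i)) · U^{⊗k}(o',i'), and define the target matrix R(U) on I₀ × O₀ by R(U)[((x₀,y₀)),((x₀',y₀'))] = U(x₀,y₀) · conj(U(x₀',y₀')). Suppose p ∈ ℝ and for every unitary U ∈ U(d): the partial trace over the middle factors I × O of S · (𝟙_{I₀} ⊗ Ω(U) ⊗ 𝟙_{O₀}) equals p · R(U). Then for all unitaries A, B ∈ U(d), the matrix S' := (A ⊗ (conj B)^{⊗k} ⊗ (conj A)^{⊗k} ⊗ B) · S · (A ⊗ (conj B)^{⊗k} ⊗ (conj A)^{⊗k} ⊗ B)† satisfies the same equation for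 every unitary U, with the same p. (This is the symmetrization step showing that unitary-transposition superinstrument elements may be assumed covariant under the twirl A ⊗ B*^{⊗k} ⊗ A*^{⊗k} ⊗ B.) -/
open Matrix

/-- The `k`-fold tensor power of a `d × d` matrix, indexed by `Fin k → Fin d`. -/
def tensorPow {d : ℕ} (k : ℕ) (U : Matrix (Fin d) (Fin d) ℂ) :
    Matrix (Fin k → Fin d) (Fin k → Fin d) ℂ :=
  fun i j => ∏ l, U (i l) (j l)

/-- The total index type `I₀ × I × O × O₀` of a parallel superinstrument element. -/
abbrev SIdx (d k : ℕ) := Fin d × (Fin k → Fin d) × (Fin k → Fin d) × Fin d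

/-- `𝟙_{I₀} ⊗ Ω(U) ⊗ 𝟙_{O₀}` where
`Ω(U)[(i,o),(i',o')] = conj (U^{⊗k} o i) * U^{⊗k} o' i'`. -/
def midOp {d : ℕ} (k : ℕ) (U : Matrix (Fin d) (Fin d) ℂ) :
    Matrix (SIdx d k) (SIdx d k) ℂ :=
  fun p q =>
    (if p.1 = q.1 then 1 else 0) *
    (star (tensorPow k U p.2.2.1 p.2.1) * tensorPow k U q.2.2.1 q.2.1) *
    (if p.2.2.2 = q.2.2.2 then 1 else 0)

/-- Partial trace over the middle factors `I × O`. -/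
noncomputable def ptraceMid {d k : ℕ} (M : Matrix (SIdx d k) (SIdx d k) ℂ) :
    Matrix (Fin d × Fin d) (Fin d × Fin d) ℂ :=
  fun a b => ∑ i : Fin k → Fin d, ∑ o : Fin k → Fin d,
    M (a.1, i, o, a.2) (b.1, i, o, b.2)

/-- The target matrix `R(U)[(x₀,y₀),(x₀',y₀')] = U x₀ y₀ * conj (U x₀' y₀')`. -/
def targetMat {d : ℕ} (U : Matrix (Fin d) (Fin d) ℂ) :
    Matrix (Fin d × Fin d) (Fin d × Fin d) ℂ :=
  fun a b => U a.1 a.2 * star (U b.1 b.2)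

/-- The twirl operator `A ⊗ (conj B)^{⊗k} ⊗ (conj A)^{⊗k} ⊗ B` on `I₀ × I × O × O₀`. -/
def twirlOp {d : ℕ} (k : ℕ) (A B : Matrix (Fin d) (Fin d) ℂ) :
    Matrix (SIdx d k) (SIdx d k) ℂ :=
  fun p q =>
    A p.1 q.1 *
    tensorPow k (B.map (starRingEnd ℂ)) p.2.1 q.2.1 *
    tensorPow k (A.map (starRingEnd ℂ)) p.2.2.1 q.2.2.1 *
    B p.2.2.2 q.2.2.2

open scoped Kronecker

section PartialTrace

variable {m n : Type*} [Fintype n]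

/-- The partial trace over the second tensor factor. -/
def ptraceSnd (M : Matrix (m × n) (m × n) ℂ) : Matrix m m ℂ :=
  fun a b => ∑ c, M (a, c) (b, c)

variable [Fintype m]

theorem ptraceSnd_kronecker_one_mul [DecidableEq n] (P : Matrix m m ℂ)
    (M : Matrix (m × n) (m × n) ℂ) :
    ptraceSnd (P ⊗ₖ (1 : Matrix n n ℂ) * M) = P * ptraceSnd M := by
  ext a b
  simp only [ptraceSnd, mul_apply, Fintype.sum_prod_type, kronecker_apply, one_apply, mul_ite,
    mul_one, mul_zero, ite_mul, zero_mul, Finset.sum_ite_eq, Finset.mem_univ, if_true,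
    Finset.mul_sum]
  exact Finset.sum_comm

theorem ptraceSnd_mul_kronecker_one [DecidableEq n] (M : Matrix (m × n) (m × n) ℂ)
    (P : Matrix m m ℂ) :
    ptraceSnd (M * P ⊗ₖ (1 : Matrix n n ℂ)) = ptraceSnd M * P := by
  ext a b
  simp only [ptraceSnd, mul_apply, Fintype.sum_prod_type, kronecker_apply, one_apply, mul_ite,
    mul_one, mul_zero, Finset.sum_ite_eq', Finset.mem_univ, if_true, Finset.sum_mul]
  exact Finset.sum_comm

theorem ptraceSnd_one_kronecker_mul_comm [DecidableEq m] (Q : Matrix n n ℂ)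
    (M : Matrix (m × n) (m × n) ℂ) :
    ptraceSnd ((1 : Matrix m m ℂ) ⊗ₖ Q * M) = ptraceSnd (M * (1 : Matrix m m ℂ) ⊗ₖ Q) := by
  ext a b
  simp only [ptraceSnd, mul_apply, Fintype.sum_prod_type, kronecker_apply, one_apply]
  rw [Finset.sum_comm]
  simp only [ite_mul, one_mul, zero_mul, mul_ite, mul_zero, Finset.sum_ite_eq, Finset.sum_ite_eq',
    Finset.sum_ite_irrel, Finset.sum_const_zero, Finset.mem_univ, if_true]
  rw [Finset.sum_comm]
  simp [mul_comm]

theorem ptraceSnd_kronecker_conj [DecidableEq m] [DecidableEq n] (P : Matrix m m ℂ)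
    (Q Ω : Matrix n n ℂ) (M : Matrix (m × n) (m × n) ℂ) :
    ptraceSnd (P ⊗ₖ Q * M * (P ⊗ₖ Q)ᴴ * (1 : Matrix m m ℂ) ⊗ₖ Ω) =
      P * ptraceSnd (M * (1 : Matrix m m ℂ) ⊗ₖ (Qᴴ * Ω * Q)) * Pᴴ := by
  have h₁ : P ⊗ₖ Q = P ⊗ₖ (1 : Matrix n n ℂ) * (1 : Matrix m m ℂ) ⊗ₖ Q := by
    rw [← mul_kronecker_mul, mul_one, one_mul]
  have h₂ : (P ⊗ₖ Q)ᴴ * (1 : Matrix m m ℂ) ⊗ₖ Ω =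
      (1 : Matrix m m ℂ) ⊗ₖ (Qᴴ * Ω) * Pᴴ ⊗ₖ (1 : Matrix n n ℂ) := by
    rw [conjTranspose_kronecker, ← mul_kronecker_mul, ← mul_kronecker_mul]
    simp only [mul_one, one_mul]
  have h₃ : (1 : Matrix m m ℂ) ⊗ₖ (Qᴴ * Ω * Q) =
      (1 : Matrix m m ℂ) ⊗ₖ (Qᴴ * Ω) * (1 : Matrix m m ℂ) ⊗ₖ Q := by
    rw [← mul_kronecker_mul, one_mul]
  rw [mul_assoc, h₂, ← mul_assoc, ptraceSnd_mul_kronecker_one, h₁, mul_assoc, mul_assoc,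
    ptraceSnd_kronecker_one_mul, ptraceSnd_one_kronecker_mul_comm, h₃, mul_assoc M]

end PartialTrace

theorem mul_vecMulVec_star_mul_conjTranspose {m n : Type*} [Fintype n] (P : Matrix m n ℂ)
    (v : n → ℂ) :
    P * vecMulVec v (star v) * Pᴴ = vecMulVec (P *ᵥ v) (star (P *ᵥ v)) := by
  rw [mul_vecMulVec, vecMulVec_mul, star_mulVec]

section TensorPow

variable {d : ℕ} (k : ℕ)

theorem tensorPow_mul (U V : Matrix (Fin d) (Fin d) ℂ) :
    tensorPow k (U * V) = tensorPow k U * tensorPow k V := by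
  ext i j
  simp only [tensorPow, mul_apply, Finset.prod_univ_sum, Fintype.piFinset_univ,
    Finset.prod_mul_distrib]

theorem tensorPow_map_star (U : Matrix (Fin d) (Fin d) ℂ) :
    tensorPow k (U.map star) = (tensorPow k U).map star := by
  ext i j
  simp [tensorPow]

theorem tensorPow_transpose (U : Matrix (Fin d) (Fin d) ℂ) :
    tensorPow k Uᵀ = (tensorPow k U)ᵀ := rfl

end TensorPow

/-- The regrouping `(I₀ × O₀) × (I × O) ≃ I₀ × I × O × O₀`. -/
def outerMidEquiv (d k : ℕ) :
    (Fin d × Fin d) × ((Fin k → Fin d) × (Fin k → Fin d)) ≃ SIdx d k where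
  toFun x := (x.1.1, x.2.1, x.2.2, x.1.2)
  invFun y := ((y.1, y.2.2.2), (y.2.1, y.2.2.1))
  left_inv _ := rfl
  right_inv _ := rfl

section Regroup

variable {d : ℕ} (k : ℕ)

theorem ptraceMid_eq_ptraceSnd (M : Matrix (SIdx d k) (SIdx d k) ℂ) :
    ptraceMid M = ptraceSnd (M.submatrix (outerMidEquiv d k) (outerMidEquiv d k)) := by
  ext a b
  simp only [ptraceMid, ptraceSnd, Fintype.sum_prod_type]
  rfl

theorem midOp_submatrix (U : Matrix (Fin d) (Fin d) ℂ) :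
    (midOp k U).submatrix (outerMidEquiv d k) (outerMidEquiv d k) =
      (1 : Matrix (Fin d × Fin d) (Fin d × Fin d) ℂ) ⊗ₖ
        vecMulVec (vec (tensorPow k (U.map star))) (star (vec (tensorPow k (U.map star)))) := by
  ext ⟨⟨a, b⟩, i, o⟩ ⟨⟨a', b'⟩, i', o'⟩
  by_cases ha : a = a' <;> by_cases hb : b = b' <;>
    simp [midOp, outerMidEquiv, tensorPow, vecMulVec_apply, vec, one_apply, ha, hb]

theorem twirlOp_submatrix (A B : Matrix (Fin d) (Fin d) ℂ) :
    (twirlOp k A B).submatrix (outerMidEquiv d k) (outerMidEquiv d k) =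
      (A ⊗ₖ B) ⊗ₖ (tensorPow k (B.map star) ⊗ₖ tensorPow k (A.map star)) := by
  ext ⟨⟨a, b⟩, i, o⟩ ⟨⟨a', b'⟩, i', o'⟩
  change A a a' * tensorPow k (B.map star) i i' * tensorPow k (A.map star) o o' * B b b' =
    A a a' * B b b' * (tensorPow k (B.map star) i i' * tensorPow k (A.map star) o o')
  ring

theorem targetMat_eq_vecMulVec (U : Matrix (Fin d) (Fin d) ℂ) :
    targetMat U = vecMulVec (vec Uᵀ) (star (vec Uᵀ)) := rfl

/-- Conjugating by the twirl replaces `U` by `Aᴴ U (conj B)` and acts by `A ⊗ B` on the outer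
factors. -/
theorem ptraceMid_twirlOp_conj (A B U : Matrix (Fin d) (Fin d) ℂ)
    (S : Matrix (SIdx d k) (SIdx d k) ℂ) :
    ptraceMid (twirlOp k A B * S * (twirlOp k A B)ᴴ * midOp k U) =
      (A ⊗ₖ B) * ptraceMid (S * midOp k (Aᴴ * U * B.map star)) * (A ⊗ₖ B)ᴴ := by
  have key : (tensorPow k (B.map star) ⊗ₖ tensorPow k (A.map star))ᴴ *ᵥ
      vec (tensorPow k (U.map star)) = vec (tensorPow k ((Aᴴ * U * B.map star).map star)) := by
    have h₁ : (Aᴴ * U * B.map star).map star = Aᵀ * U.map star * B := by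
      ext i j
      simp [mul_apply]
    have h₂ : (tensorPow k (A.map star))ᴴ = tensorPow k Aᵀ := by
      rw [tensorPow_map_star, tensorPow_transpose]
      ext i j
      simp
    have h₃ : (tensorPow k (B.map star))ᴴᵀ = tensorPow k B := by
      rw [tensorPow_map_star]
      ext i j
      simp
    rw [conjTranspose_kronecker, kronecker_mulVec_vec, h₁, h₂, h₃, tensorPow_mul, tensorPow_mul]
  simp only [ptraceMid_eq_ptraceSnd, ← submatrix_mul_equiv _ _ _ (outerMidEquiv d k),
    ← conjTranspose_submatrix, midOp_submatrix, twirlOp_submatrix]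
  rw [ptraceSnd_kronecker_conj, ← key, ← mul_vecMulVec_star_mul_conjTranspose,
    conjTranspose_conjTranspose]

end Regroup

theorem kronecker_mul_targetMat_mul_conjTranspose {d : ℕ} (A B W : Matrix (Fin d) (Fin d) ℂ) :
    (A ⊗ₖ B) * targetMat W * (A ⊗ₖ B)ᴴ = targetMat (A * W * Bᵀ) := by
  rw [targetMat_eq_vecMulVec, mul_vecMulVec_star_mul_conjTranspose, kronecker_mulVec_vec,
    targetMat_eq_vecMulVec, transpose_mul, transpose_mul, transpose_transpose, mul_assoc]

/-- **Covariance of unitary-transposition superinstrument elements under the twirl**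
`A ⊗ B*^{⊗k} ⊗ A*^{⊗k} ⊗ B`: if `S` implements `U ↦ p·Uᵀ` for every unitary `U`, then so
does `S' = (A ⊗ B*^{⊗k} ⊗ A*^{⊗k} ⊗ B) S (A ⊗ B*^{⊗k} ⊗ A*^{⊗k} ⊗ B)†`. -/
theorem transposition_twirl_covariance (d k : ℕ) (hd : 1 ≤ d) (hk : 1 ≤ k)
    (S : Matrix (SIdx d k) (SIdx d k) ℂ) (p : ℝ)
    (h : ∀ U : Matrix.unitaryGroup (Fin d) ℂ,
      ptraceMid (S * midOp k (U : Matrix (Fin d) (Fin d) ℂ)) =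
        (p : ℂ) • targetMat (U : Matrix (Fin d) (Fin d) ℂ)) :
    ∀ A B : Matrix.unitaryGroup (Fin d) ℂ,
      ∀ U : Matrix.unitaryGroup (Fin d) ℂ,
        ptraceMid
          ((twirlOp k (A : Matrix (Fin d) (Fin d) ℂ) (B : Matrix (Fin d) (Fin d) ℂ) * S *
              (twirlOp k (A : Matrix (Fin d) (Fin d) ℂ) (B : Matrix (Fin d) (Fin d) ℂ))ᴴ) *
            midOp k (U : Matrix (Fin d) (Fin d) ℂ)) =
          (p : ℂ) • targetMat (U : Matrix (Fin d) (Fin d) ℂ) := by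
  intro A B U
  have hA : (A : Matrix (Fin d) (Fin d) ℂ) * (A : Matrix (Fin d) (Fin d) ℂ)ᴴ = 1 :=
    mem_unitaryGroup_iff.mp A.2
  have hB : (B : Matrix (Fin d) (Fin d) ℂ) * (B : Matrix (Fin d) (Fin d) ℂ)ᴴ = 1 :=
    mem_unitaryGroup_iff.mp B.2
  have hB' : (B : Matrix (Fin d) (Fin d) ℂ).map star * (B : Matrix (Fin d) (Fin d) ℂ)ᵀ = 1 := by
    rw [← transpose_one, ← hB, transpose_mul]
    rfl
  have hW : (A : Matrix (Fin d) (Fin d) ℂ)ᴴ * U * (B : Matrix (Fin d) (Fin d) ℂ).map star ∈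
      unitaryGroup (Fin d) ℂ := by
    refine mul_mem (mul_mem (Unitary.star_mem A.2) U.2) (mem_unitaryGroup_iff.mpr ?_)
    rw [← hB', star_eq_conjTranspose]
    congr 1
    ext i j
    simp
  rw [ptraceMid_twirlOp_conj, h ⟨_, hW⟩, Matrix.mul_smul, Matrix.smul_mul,
    kronecker_mul_targetMat_mul_conjTranspose]
  congr 2
  rw [mul_assoc, mul_assoc _ _ (_ᵀ), hB', mul_one, ← mul_assoc, hA, one_mul]
end
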